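/- arXiv:1905.02572 — 2 statements merged into one kernel-verified Lean document; each statement's English description precedes it below -/
import Mathlib

section
/- Let 1 ≤ r, s, p ≤ ∞ and θ ∈ [0,1] satisfy 1/p = (1−θ)/r + θ/s (with the convention 1/∞ = 0). Then for every real-linear map T on the real vector space H_n of n×n complex Hermitian matrices one has ‖T‖_{p→p} ≤ ‖T‖_{r→r}^{1−θ} · ‖T‖_{s→s}^{θ}. -/
open scoped ENNReal

/-- The spectral `p`-norm of a Hermitian matrix: the `p`-norm of its eigenvalue vector.
(Junk value `0` for non-Hermitian matrices.) -/
noncomputable def specPNorm {n : ℕ} (p : ℝ≥0∞) (A : Matrix (Fin n) (Fin n) ℂ) : ℝ :=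
  if hA : A.IsHermitian then
    (if p = ∞ then ⨆ i, |hA.eigenvalues i|
     else (∑ i, |hA.eigenvalues i| ^ p.toReal) ^ (1 / p.toReal))
  else 0

/-- The operator norm of a real-linear map on Hermitian matrices (represented as a real-linear
map on all matrices), from the spectral `r`-norm to the spectral `s`-norm: the supremum of
`‖T A‖_s / ‖A‖_r` over nonzero Hermitian `A`. -/
noncomputable def hermOpNorm {n : ℕ} (r s : ℝ≥0∞)
    (T : Matrix (Fin n) (Fin n) ℂ →ₗ[ℝ] Matrix (Fin n) (Fin n) ℂ) : ℝ :=
  ⨆ A : {A : Matrix (Fin n) (Fin n) ℂ // A.IsHermitian ∧ A ≠ 0},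
    specPNorm s (T A.1) / specPNorm r A.1

/-- The least value of `u ^ r + τ (1 - u) ^ s` over `u ∈ [0, 1]`. -/
noncomputable def splitCost (r s τ : ℝ) : ℝ :=
  sInf ((fun u : ℝ => u ^ r + τ * (1 - u) ^ s) '' Set.Icc 0 1)

/-- The least value of `|u| ^ r + t |v| ^ s` over real splittings `u + v = y`. -/
noncomputable def splitGauge (r s t y : ℝ) : ℝ :=
  |y| ^ r * splitCost r s (t * |y| ^ (s - r))

section SplitCost

variable {r s : ℝ}

lemma exists_splitCost_eq (hr : 0 < r) (hs : 0 < s) (τ : ℝ) :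
    ∃ u ∈ Set.Icc (0 : ℝ) 1, splitCost r s τ = u ^ r + τ * (1 - u) ^ s := by
  have hc : Continuous fun u : ℝ => u ^ r + τ * (1 - u) ^ s :=
    (Real.continuous_rpow_const hr.le).add
      (continuous_const.mul ((continuous_const.sub continuous_id).rpow_const
        fun _ => Or.inr hs.le))
  obtain ⟨u, hu, h⟩ := (isCompact_Icc.image hc).sInf_mem
    ((Set.nonempty_Icc.2 (zero_le_one' ℝ)).image fun u : ℝ => u ^ r + τ * (1 - u) ^ s)
  exact ⟨u, hu, h.symm⟩

lemma splitCost_le {τ u : ℝ} (hτ : 0 ≤ τ) (hu : u ∈ Set.Icc (0 : ℝ) 1) :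
    splitCost r s τ ≤ u ^ r + τ * (1 - u) ^ s := by
  refine csInf_le ⟨0, ?_⟩ ⟨u, hu, rfl⟩
  rintro _ ⟨v, hv, rfl⟩
  have h1 := Real.rpow_nonneg hv.1 r
  have h2 := Real.rpow_nonneg (sub_nonneg.2 hv.2) s
  dsimp only
  positivity

lemma splitCost_nonneg (hr : 0 < r) (hs : 0 < s) {τ : ℝ} (hτ : 0 ≤ τ) : 0 ≤ splitCost r s τ := by
  obtain ⟨u, hu, h⟩ := exists_splitCost_eq hr hs τ
  have h1 := Real.rpow_nonneg hu.1 r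
  have h2 := Real.rpow_nonneg (sub_nonneg.2 hu.2) s
  rw [h]
  positivity

lemma splitCost_pos (hr : 0 < r) (hs : 0 < s) {τ : ℝ} (hτ : 0 < τ) : 0 < splitCost r s τ := by
  obtain ⟨u, hu, h⟩ := exists_splitCost_eq hr hs τ
  have h1 := Real.rpow_nonneg hu.1 r
  have h2 := Real.rpow_nonneg (sub_nonneg.2 hu.2) s
  rw [h]
  rcases hu.1.eq_or_lt with h0 | h0
  · subst h0
    simp [Real.zero_rpow hr.ne', hτ]
  · have := Real.rpow_pos_of_pos h0 r
    positivity

lemma splitCost_le_one (hs : 0 < s) {τ : ℝ} (hτ : 0 ≤ τ) : splitCost r s τ ≤ 1 := by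
  simpa [Real.zero_rpow hs.ne'] using splitCost_le (r := r) (s := s) hτ (u := 1) (by simp)

lemma splitCost_le_self (hr : 0 < r) {τ : ℝ} (hτ : 0 ≤ τ) : splitCost r s τ ≤ τ := by
  simpa [Real.zero_rpow hr.ne'] using splitCost_le (r := r) (s := s) hτ (u := 0) (by simp)

lemma monotoneOn_splitCost (hr : 0 < r) (hs : 0 < s) :
    MonotoneOn (splitCost r s) (Set.Ioi 0) := by
  intro a ha b _ hab
  obtain ⟨u, hu, h⟩ := exists_splitCost_eq hr hs b
  rw [h]
  refine (splitCost_le (le_of_lt ha) hu).trans ?_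
  have h2 := Real.rpow_nonneg (sub_nonneg.2 hu.2) s
  gcongr

lemma splitGauge_eq_zero (hr : 0 < r) (t : ℝ) : splitGauge r s t 0 = 0 := by
  simp [splitGauge, Real.zero_rpow hr.ne']

lemma abs_rpow_mul_splitting {y : ℝ} (hy : y ≠ 0) (t a b : ℝ) :
    |y| ^ r * (a + t * |y| ^ (s - r) * b) = |y| ^ r * a + t * (|y| ^ s * b) := by
  have h : |y| ^ s = |y| ^ r * |y| ^ (s - r) := by
    rw [← Real.rpow_add (abs_pos.2 hy)]; ring_nf
  rw [h]; ring

lemma exists_splitGauge_eq (hr : 0 < r) (hs : 0 < s) (t y : ℝ) :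
    ∃ u v, u + v = y ∧ |u| ^ r + t * |v| ^ s = splitGauge r s t y := by
  rcases eq_or_ne y 0 with rfl | hy
  · exact ⟨0, 0, by simp, by simp [splitGauge_eq_zero hr, Real.zero_rpow hr.ne',
      Real.zero_rpow hs.ne']⟩
  · obtain ⟨u, hu, h⟩ := exists_splitCost_eq hr hs (t * |y| ^ (s - r))
    refine ⟨y * u, y * (1 - u), by ring, ?_⟩
    rw [splitGauge, h, abs_rpow_mul_splitting hy, abs_mul, abs_mul, abs_of_nonneg hu.1,
      abs_of_nonneg (sub_nonneg.2 hu.2), Real.mul_rpow (abs_nonneg _) hu.1,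
      Real.mul_rpow (abs_nonneg _) (sub_nonneg.2 hu.2)]

lemma splitGauge_add_le (hr : 0 < r) (hs : 0 < s) {t : ℝ} (ht : 0 ≤ t) (x z : ℝ) :
    splitGauge r s t (x + z) ≤ |x| ^ r + t * |z| ^ s := by
  rcases eq_or_ne (x + z) 0 with hy | hy
  · rw [hy, splitGauge_eq_zero hr]
    positivity
  · set y := x + z with hyd
    have hz : 1 - x / y = z / y := by rw [hyd] at hy ⊢; field_simp; ring
    set u := max 0 (min 1 (x / y)) with hu
    have hu0 : 0 ≤ u := le_max_left _ _
    have hu1 : u ≤ 1 := max_le zero_le_one (min_le_left _ _)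
    have hux : u ≤ |x / y| :=
      max_le (abs_nonneg _) ((min_le_right _ _).trans (le_abs_self _))
    have huz : 1 - u ≤ |z / y| := by
      rw [← hz]
      have h1 := le_abs_self (1 - x / y)
      have h2 : min 1 (x / y) ≤ u := le_max_right _ _
      rcases min_choice 1 (x / y) with h | h <;> rw [h] at h2
      · linarith [abs_nonneg (1 - x / y)]
      · linarith
    have hy' := abs_pos.2 hy
    calc splitGauge r s t y
        ≤ |y| ^ r * (u ^ r + t * |y| ^ (s - r) * (1 - u) ^ s) :=
          mul_le_mul_of_nonneg_left (splitCost_le (by positivity) ⟨hu0, hu1⟩) (by positivity)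
      _ = |y| ^ r * u ^ r + t * (|y| ^ s * (1 - u) ^ s) := abs_rpow_mul_splitting hy _ _ _
      _ ≤ |y| ^ r * |x / y| ^ r + t * (|y| ^ s * |z / y| ^ s) := by
          have h1u := sub_nonneg.2 hu1
          gcongr
      _ = |x| ^ r + t * |z| ^ s := by
          rw [← Real.mul_rpow (abs_nonneg _) (abs_nonneg _),
            ← Real.mul_rpow (abs_nonneg _) (abs_nonneg _), ← abs_mul, ← abs_mul,
            mul_div_cancel₀ _ hy, mul_div_cancel₀ _ hy]

lemma integrableOn_rpow_mul_splitCost (hr : 0 < r) (hs : 0 < s) {η : ℝ} (hη0 : 0 < η)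
    (hη1 : η < 1) :
    MeasureTheory.IntegrableOn (fun t : ℝ => t ^ (-η - 1) * splitCost r s t) (Set.Ioi 0) := by
  have hm : MeasureTheory.AEStronglyMeasurable (fun t : ℝ => t ^ (-η - 1) * splitCost r s t)
      (MeasureTheory.volume.restrict (Set.Ioi 0)) :=
    ((measurable_id.pow_const _).aemeasurable.mul
      (aemeasurable_restrict_of_monotoneOn measurableSet_Ioi
        (monotoneOn_splitCost hr hs))).aestronglyMeasurable
  rw [← Set.Ioc_union_Ioi_eq_Ioi (zero_le_one' ℝ)]
  refine MeasureTheory.IntegrableOn.union ?_ ?_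
  · have hi : MeasureTheory.IntegrableOn (fun t : ℝ => t ^ (-η)) (Set.Ioc 0 1) :=
      (intervalIntegrable_iff_integrableOn_Ioc_of_le zero_le_one).1
        (intervalIntegral.intervalIntegrable_rpow' (by linarith))
    refine hi.mono' (hm.mono_set Set.Ioc_subset_Ioi_self) ?_
    filter_upwards [MeasureTheory.self_mem_ae_restrict measurableSet_Ioc] with t ht
    have h0 := splitCost_nonneg hr hs ht.1.le
    have ht0 := ht.1
    rw [Real.norm_of_nonneg (by positivity)]
    calc t ^ (-η - 1) * splitCost r s t ≤ t ^ (-η - 1) * t := by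
          gcongr; exact splitCost_le_self hr ht.1.le
      _ = t ^ (-η) := by
          rw [← Real.rpow_add_one ht0.ne']; ring_nf
  · refine (integrableOn_Ioi_rpow_of_lt (a := -η - 1) (by linarith) one_pos).mono'
      (hm.mono_set (Set.Ioi_subset_Ioi zero_le_one)) ?_
    filter_upwards [MeasureTheory.self_mem_ae_restrict measurableSet_Ioi] with t ht
    have ht0 : 0 < t := one_pos.trans ht
    have h0 := splitCost_nonneg hr hs ht0.le
    rw [Real.norm_of_nonneg (by positivity)]
    exact mul_le_of_le_one_right (by positivity) (splitCost_le_one hs ht0.le)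

lemma integral_rpow_mul_splitCost_pos (hr : 0 < r) (hs : 0 < s) {η : ℝ} (hη0 : 0 < η)
    (hη1 : η < 1) : 0 < ∫ t in Set.Ioi (0 : ℝ), t ^ (-η - 1) * splitCost r s t := by
  have hpos : ∀ t ∈ Set.Ioi (0 : ℝ), 0 < t ^ (-η - 1) * splitCost r s t := fun t ht =>
    mul_pos (Real.rpow_pos_of_pos ht _) (splitCost_pos hr hs ht)
  rw [MeasureTheory.setIntegral_pos_iff_support_of_nonneg_ae _
    (integrableOn_rpow_mul_splitCost hr hs hη0 hη1),
    Set.inter_eq_right.2 (show Set.Ioi (0 : ℝ) ⊆ Function.support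
      fun t : ℝ => t ^ (-η - 1) * splitCost r s t from fun t ht => (hpos t ht).ne')]
  · simp
  · filter_upwards [MeasureTheory.self_mem_ae_restrict measurableSet_Ioi] with t ht
    exact (hpos t ht).le

lemma rpow_mul_splitGauge_eq {η κ t y : ℝ} (hκ : 0 < κ) (ht : 0 < t) (hy : y ≠ 0) :
    t ^ (-η - 1) * splitGauge r s (κ * t) y =
      |y| ^ r * (κ * |y| ^ (s - r)) ^ (η + 1) *
        (((κ * |y| ^ (s - r)) * t) ^ (-η - 1) * splitCost r s ((κ * |y| ^ (s - r)) * t)) := by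
  have hy' := abs_pos.2 hy
  have ha : 0 < κ * |y| ^ (s - r) := by positivity
  set a := κ * |y| ^ (s - r) with had
  have h1 : a ^ (η + 1) * a ^ (-η - 1) = 1 := by
    rw [← Real.rpow_add ha]; simp
  rw [splitGauge, Real.mul_rpow ha.le ht.le, show κ * t * |y| ^ (s - r) = a * t by rw [had]; ring]
  linear_combination (-(|y| ^ r * t ^ (-η - 1) * splitCost r s (a * t))) * h1

lemma integrableOn_rpow_mul_splitGauge (hr : 0 < r) (hs : 0 < s) {η κ : ℝ} (hη0 : 0 < η)
    (hη1 : η < 1) (hκ : 0 < κ) (y : ℝ) :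
    MeasureTheory.IntegrableOn (fun t : ℝ => t ^ (-η - 1) * splitGauge r s (κ * t) y)
      (Set.Ioi 0) := by
  rcases eq_or_ne y 0 with rfl | hy
  · simp [splitGauge_eq_zero hr]
  · have hy' := abs_pos.2 hy
    have ha : 0 < κ * |y| ^ (s - r) := by positivity
    refine MeasureTheory.IntegrableOn.congr_fun (MeasureTheory.Integrable.const_mul
      ((MeasureTheory.integrableOn_Ioi_comp_mul_left_iff
        (fun t : ℝ => t ^ (-η - 1) * splitCost r s t) 0 ha).2 ?_) _)
      (fun t ht => (rpow_mul_splitGauge_eq hκ ht hy).symm) measurableSet_Ioi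
    rw [mul_zero]
    exact integrableOn_rpow_mul_splitCost hr hs hη0 hη1

lemma integral_rpow_mul_splitGauge (hr : 0 < r) (hs : 0 < s) {η κ : ℝ} (hη0 : 0 < η)
    (hη1 : η < 1) (hκ : 0 < κ) (y : ℝ) :
    ∫ t in Set.Ioi (0 : ℝ), t ^ (-η - 1) * splitGauge r s (κ * t) y =
      κ ^ η * |y| ^ ((1 - η) * r + η * s) *
        ∫ t in Set.Ioi (0 : ℝ), t ^ (-η - 1) * splitCost r s t := by
  rcases eq_or_ne y 0 with rfl | hy
  · have : (1 - η) * r + η * s ≠ 0 := by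
      have := sub_pos.2 hη1
      positivity
    simp [splitGauge_eq_zero hr, Real.zero_rpow this]
  · have hy' := abs_pos.2 hy
    have ha : 0 < κ * |y| ^ (s - r) := by positivity
    rw [MeasureTheory.setIntegral_congr_fun measurableSet_Ioi
      (fun t ht => rpow_mul_splitGauge_eq hκ ht hy), MeasureTheory.integral_const_mul,
      MeasureTheory.integral_comp_mul_left_Ioi
        (fun t : ℝ => t ^ (-η - 1) * splitCost r s t) 0 ha, mul_zero, smul_eq_mul, ← mul_assoc]
    congr 1
    rw [Real.rpow_add_one ha.ne', mul_assoc, mul_assoc, mul_inv_cancel₀ ha.ne', mul_one,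
      Real.mul_rpow hκ.le (by positivity), ← Real.rpow_mul hy'.le, mul_left_comm,
      ← Real.rpow_add hy']
    ring_nf

/-- Integrating an inequality between `splitGauge` sums against `t ^ (-η - 1)`. -/
lemma sum_rpow_le_of_splitGauge_le (hr : 0 < r) (hs : 0 < s) {η κ K : ℝ} (hη0 : 0 < η)
    (hη1 : η < 1) (hκ : 0 < κ) {ι : Type*} [Fintype ι] {μ ν : ι → ℝ}
    (h : ∀ t > 0, ∑ i, splitGauge r s t (μ i) ≤ K * ∑ i, splitGauge r s (κ * t) (ν i)) :
    ∑ i, |μ i| ^ ((1 - η) * r + η * s) ≤ K * κ ^ η * ∑ i, |ν i| ^ ((1 - η) * r + η * s) := by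
  have hc := integral_rpow_mul_splitCost_pos hr hs hη0 hη1
  refine le_of_mul_le_mul_right ?_ hc
  have key : ∫ t in Set.Ioi (0 : ℝ), ∑ i, t ^ (-η - 1) * splitGauge r s (1 * t) (μ i) ≤
      ∫ t in Set.Ioi (0 : ℝ), K * ∑ i, t ^ (-η - 1) * splitGauge r s (κ * t) (ν i) := by
    refine MeasureTheory.setIntegral_mono_on
      (MeasureTheory.integrable_finsetSum _ fun i _ =>
        integrableOn_rpow_mul_splitGauge hr hs hη0 hη1 one_pos (μ i))
      (MeasureTheory.Integrable.const_mul (MeasureTheory.integrable_finsetSum _ fun i _ =>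
        integrableOn_rpow_mul_splitGauge hr hs hη0 hη1 hκ (ν i)) K) measurableSet_Ioi ?_
    intro t ht
    rw [← Finset.mul_sum, ← Finset.mul_sum, mul_left_comm, one_mul]
    exact mul_le_mul_of_nonneg_left (h t ht) (Real.rpow_nonneg (le_of_lt ht) _)
  rw [MeasureTheory.integral_const_mul,
    MeasureTheory.integral_finsetSum _ fun i _ =>
      integrableOn_rpow_mul_splitGauge hr hs hη0 hη1 one_pos (μ i),
    MeasureTheory.integral_finsetSum _ fun i _ =>
      integrableOn_rpow_mul_splitGauge hr hs hη0 hη1 hκ (ν i)] at key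
  simp only [integral_rpow_mul_splitGauge hr hs hη0 hη1 one_pos,
    integral_rpow_mul_splitGauge hr hs hη0 hη1 hκ] at key
  simp only [← Finset.sum_mul, ← Finset.mul_sum, Real.one_rpow, one_mul] at key
  linarith

end SplitCost

section Hermitian

variable {n : ℕ}

/-- **Schur's inequality** for convex functions: the diagonal of a Hermitian matrix in any
orthonormal basis is majorized by its spectrum. -/
lemma sum_convex_diag_le {f : ℝ → ℝ} (hf : ConvexOn ℝ Set.univ f)
    (U V : Matrix.unitaryGroup (Fin n) ℂ) (ν : Fin n → ℝ) :
    ∑ i, f ((star (U : Matrix (Fin n) (Fin n) ℂ) *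
      (V * Matrix.diagonal (fun j => (ν j : ℂ)) * star (V : Matrix (Fin n) (Fin n) ℂ)) *
        (U : Matrix (Fin n) (Fin n) ℂ)) i i).re ≤ ∑ j, f (ν j) := by
  set W : Matrix.unitaryGroup (Fin n) ℂ := star U * V with hW
  have hconj : star (U : Matrix (Fin n) (Fin n) ℂ) *
      (V * Matrix.diagonal (fun j => (ν j : ℂ)) * star (V : Matrix (Fin n) (Fin n) ℂ)) *
        (U : Matrix (Fin n) (Fin n) ℂ) =
      W * Matrix.diagonal (fun j => (ν j : ℂ)) * star (W : Matrix (Fin n) (Fin n) ℂ) := by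
    simp [hW, mul_assoc]
  have hentry : ∀ i, ((W * Matrix.diagonal (fun j => (ν j : ℂ)) *
      star (W : Matrix (Fin n) (Fin n) ℂ)) i i).re = ∑ j, ‖W i j‖ ^ 2 • ν j := by
    intro i
    rw [Matrix.mul_apply, Complex.re_sum]
    refine Finset.sum_congr rfl fun j _ => ?_
    rw [Matrix.mul_diagonal, Matrix.star_apply, mul_right_comm, Complex.star_def,
      Complex.mul_conj, ← Complex.ofReal_mul, Complex.ofReal_re, Complex.normSq_eq_norm_sq,
      smul_eq_mul]
  have hrow : ∀ i, ∑ j, ‖W i j‖ ^ 2 = 1 := by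
    intro i
    have h := congr_arg (fun M : Matrix (Fin n) (Fin n) ℂ => (M i i).re)
      (Matrix.mem_unitaryGroup_iff.1 W.2)
    simpa [Matrix.mul_apply, Complex.mul_conj, Complex.normSq_eq_norm_sq, ← Complex.ofReal_pow]
      using h
  have hcol : ∀ j, ∑ i, ‖W i j‖ ^ 2 = 1 := by
    intro j
    have h := congr_arg (fun M : Matrix (Fin n) (Fin n) ℂ => (M j j).re)
      (Matrix.mem_unitaryGroup_iff'.1 W.2)
    simpa [Matrix.mul_apply, mul_comm (star _), mul_comm (starRingEnd ℂ _), Complex.mul_conj,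
      Complex.normSq_eq_norm_sq, ← Complex.ofReal_pow] using h
  rw [hconj]
  calc ∑ i, f ((W * Matrix.diagonal (fun j => (ν j : ℂ)) *
        star (W : Matrix (Fin n) (Fin n) ℂ)) i i).re
      ≤ ∑ i, ∑ j, ‖W i j‖ ^ 2 • f (ν j) := Finset.sum_le_sum fun i _ => by
        rw [hentry]
        exact hf.map_sum_le (fun j _ => by positivity) (hrow i) fun _ _ => Set.mem_univ _
    _ = ∑ j, f (ν j) := by
        rw [Finset.sum_comm]
        simp_rw [← Finset.sum_smul, hcol, one_smul]

lemma convexOn_abs_rpow {r : ℝ} (hr : 1 ≤ r) : ConvexOn ℝ Set.univ fun x : ℝ => |x| ^ r := by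
  refine ⟨convex_univ, fun x _ y _ a b ha hb hab => ?_⟩
  have h := (convexOn_rpow hr).2 (abs_nonneg x) (abs_nonneg y) ha hb hab
  refine le_trans (Real.rpow_le_rpow (abs_nonneg _) ?_ (by linarith)) h
  calc |a • x + b • y| ≤ |a • x| + |b • y| := abs_add_le _ _
    _ = a • |x| + b • |y| := by simp [abs_mul, abs_of_nonneg ha, abs_of_nonneg hb]

/-- The Hermitian matrix with eigenvectors the columns of `U` and eigenvalues `u`. -/
noncomputable def conjDiag (U : Matrix.unitaryGroup (Fin n) ℂ) (u : Fin n → ℝ) :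
    Matrix (Fin n) (Fin n) ℂ :=
  U * Matrix.diagonal (fun j => (u j : ℂ)) * star (U : Matrix (Fin n) (Fin n) ℂ)

lemma isHermitian_conjDiag (U : Matrix.unitaryGroup (Fin n) ℂ) (u : Fin n → ℝ) :
    (conjDiag U u).IsHermitian := by
  rw [conjDiag, Matrix.star_eq_conjTranspose]
  refine Matrix.isHermitian_mul_mul_conjTranspose _
    (Matrix.isHermitian_diagonal_of_self_adjoint _ ?_)
  ext i; simp

lemma conjDiag_add (U : Matrix.unitaryGroup (Fin n) ℂ) (u v : Fin n → ℝ) :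
    conjDiag U (fun i => u i + v i) = conjDiag U u + conjDiag U v := by
  simp only [conjDiag, ← add_mul, ← mul_add, Matrix.diagonal_add, Complex.ofReal_add]

lemma Matrix.IsHermitian.conjDiag_eigenvalues {A : Matrix (Fin n) (Fin n) ℂ} (hA : A.IsHermitian) :
    conjDiag hA.eigenvectorUnitary hA.eigenvalues = A :=
  hA.spectral_theorem.symm

lemma re_diag_conjDiag (U : Matrix.unitaryGroup (Fin n) ℂ) (u : Fin n → ℝ) (i : Fin n) :
    ((star (U : Matrix (Fin n) (Fin n) ℂ) * conjDiag U u * (U : Matrix (Fin n) (Fin n) ℂ)) i i).re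
      = u i := by
  have h : star (U : Matrix (Fin n) (Fin n) ℂ) * (U : Matrix (Fin n) (Fin n) ℂ) = 1 :=
    Matrix.mem_unitaryGroup_iff'.1 U.2
  rw [conjDiag, mul_assoc, mul_assoc, h, mul_one, ← mul_assoc, h, one_mul]
  simp

lemma Matrix.IsHermitian.eigenvalues_eq_re_diag {A : Matrix (Fin n) (Fin n) ℂ}
    (hA : A.IsHermitian) (i : Fin n) :
    hA.eigenvalues i = ((star (hA.eigenvectorUnitary : Matrix (Fin n) (Fin n) ℂ) * A *
      (hA.eigenvectorUnitary : Matrix (Fin n) (Fin n) ℂ)) i i).re := by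
  have h := re_diag_conjDiag hA.eigenvectorUnitary hA.eigenvalues i
  rw [hA.conjDiag_eigenvalues] at h
  exact h.symm

lemma sum_convex_eigenvalues_conjDiag_le {f : ℝ → ℝ} (hf : ConvexOn ℝ Set.univ f)
    (U : Matrix.unitaryGroup (Fin n) ℂ) (u : Fin n → ℝ) :
    ∑ i, f ((isHermitian_conjDiag U u).eigenvalues i) ≤ ∑ i, f (u i) := by
  have hA := isHermitian_conjDiag U u
  calc ∑ i, f (hA.eigenvalues i)
      = ∑ i, f ((star (hA.eigenvectorUnitary : Matrix (Fin n) (Fin n) ℂ) * conjDiag U u *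
          (hA.eigenvectorUnitary : Matrix (Fin n) (Fin n) ℂ)) i i).re :=
        Finset.sum_congr rfl fun i _ => congr_arg f (hA.eigenvalues_eq_re_diag i)
    _ ≤ ∑ i, f (u i) := sum_convex_diag_le hf _ U u

lemma sum_convex_re_diag_le {f : ℝ → ℝ} (hf : ConvexOn ℝ Set.univ f)
    (U : Matrix.unitaryGroup (Fin n) ℂ) {A : Matrix (Fin n) (Fin n) ℂ} (hA : A.IsHermitian) :
    ∑ i, f ((star (U : Matrix (Fin n) (Fin n) ℂ) * A * (U : Matrix (Fin n) (Fin n) ℂ)) i i).re ≤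
      ∑ i, f (hA.eigenvalues i) := by
  conv_lhs => rw [← hA.conjDiag_eigenvalues]
  exact sum_convex_diag_le hf U _ _

open scoped Matrix.Norms.L2Operator in
lemma Matrix.IsHermitian.l2_opNorm_eq {A : Matrix (Fin n) (Fin n) ℂ} (hA : A.IsHermitian) :
    ‖A‖ = ‖hA.eigenvalues‖ := by
  conv_lhs => rw [← hA.conjDiag_eigenvalues, conjDiag]
  rw [CStarRing.norm_mul_mem_unitary _ (Unitary.star_mem hA.eigenvectorUnitary.2),
    CStarRing.norm_coe_unitary_mul, Matrix.l2_opNorm_diagonal]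
  simp [Pi.norm_def]

end Hermitian

section Interpolation

variable {n : ℕ}

lemma specPNorm_nonneg (p : ℝ≥0∞) (A : Matrix (Fin n) (Fin n) ℂ) : 0 ≤ specPNorm p A := by
  unfold specPNorm
  split_ifs
  · exact Real.iSup_nonneg fun _ => abs_nonneg _
  · positivity
  · exact le_rfl

lemma hermOpNorm_nonneg (r s : ℝ≥0∞)
    (T : Matrix (Fin n) (Fin n) ℂ →ₗ[ℝ] Matrix (Fin n) (Fin n) ℂ) : 0 ≤ hermOpNorm r s T :=
  Real.iSup_nonneg fun _ => div_nonneg (specPNorm_nonneg _ _) (specPNorm_nonneg _ _)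

lemma specPNorm_of_ne_top {A : Matrix (Fin n) (Fin n) ℂ} (hA : A.IsHermitian) {p : ℝ≥0∞}
    (hp : p ≠ ∞) :
    specPNorm p A = (∑ i, |hA.eigenvalues i| ^ p.toReal) ^ (1 / p.toReal) := by
  rw [specPNorm, dif_pos hA, if_neg hp]

lemma specPNorm_ofReal {A : Matrix (Fin n) (Fin n) ℂ} (hA : A.IsHermitian) {p : ℝ} (hp : 0 ≤ p) :
    specPNorm (ENNReal.ofReal p) A = (∑ i, |hA.eigenvalues i| ^ p) ^ (1 / p) := by
  rw [specPNorm_of_ne_top hA ENNReal.ofReal_ne_top, ENNReal.toReal_ofReal hp]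

lemma specPNorm_top {A : Matrix (Fin n) (Fin n) ℂ} (hA : A.IsHermitian) :
    specPNorm ∞ A = ‖hA.eigenvalues‖ := by
  rw [specPNorm, dif_pos hA, if_pos rfl]
  refine le_antisymm (Real.iSup_le (fun i => norm_le_pi_norm hA.eigenvalues i) (norm_nonneg _)) ?_
  refine (pi_norm_le_iff_of_nonneg (Real.iSup_nonneg fun _ => abs_nonneg _)).2 fun i => ?_
  exact le_ciSup (f := fun i => |hA.eigenvalues i|) (Set.finite_range _).bddAbove i

lemma specPNorm_top_le {A : Matrix (Fin n) (Fin n) ℂ} (hA : A.IsHermitian) {p : ℝ≥0∞}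
    (hp : 1 ≤ p) : specPNorm ∞ A ≤ specPNorm p A := by
  rcases eq_or_ne p ∞ with rfl | hpt
  · exact le_rfl
  have hp0 : 0 < p.toReal := ENNReal.toReal_pos (one_pos.trans_le hp).ne' hpt
  rw [specPNorm_top hA, pi_norm_le_iff_of_nonneg (specPNorm_nonneg _ _)]
  intro i
  rw [specPNorm_of_ne_top hA hpt, Real.norm_eq_abs, one_div,
    Real.le_rpow_inv_iff_of_pos (abs_nonneg _) (by positivity) hp0]
  exact Finset.single_le_sum (f := fun i => |hA.eigenvalues i| ^ p.toReal)
    (fun _ _ => by positivity) (Finset.mem_univ i)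

lemma specPNorm_le_mul_top {A : Matrix (Fin n) (Fin n) ℂ} (hA : A.IsHermitian) {p : ℝ≥0∞}
    (hp : 1 ≤ p) : specPNorm p A ≤ ((n : ℝ) + 1) ^ (1 / p.toReal) * specPNorm ∞ A := by
  rcases eq_or_ne p ∞ with rfl | hpt
  · simp
  have hp0 : 0 < p.toReal := ENNReal.toReal_pos (one_pos.trans_le hp).ne' hpt
  rw [specPNorm_of_ne_top hA hpt, specPNorm_top hA]
  calc (∑ i, |hA.eigenvalues i| ^ p.toReal) ^ (1 / p.toReal)
      ≤ (((n : ℝ) + 1) * ‖hA.eigenvalues‖ ^ p.toReal) ^ (1 / p.toReal) := by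
        gcongr
        calc ∑ i, |hA.eigenvalues i| ^ p.toReal
            ≤ ∑ _i : Fin n, ‖hA.eigenvalues‖ ^ p.toReal := by
              gcongr with i
              exact norm_le_pi_norm hA.eigenvalues i
          _ = n * ‖hA.eigenvalues‖ ^ p.toReal := by simp
          _ ≤ _ := by gcongr; linarith
    _ = _ := by
        rw [Real.mul_rpow (by positivity) (by positivity), ← Real.rpow_mul (norm_nonneg _),
          mul_one_div_cancel hp0.ne', Real.rpow_one]

open scoped Matrix.Norms.L2Operator in
lemma specPNorm_top_eq_l2_opNorm {A : Matrix (Fin n) (Fin n) ℂ} (hA : A.IsHermitian) :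
    specPNorm ∞ A = ‖A‖ := by
  rw [specPNorm_top hA, hA.l2_opNorm_eq]

open scoped Matrix.Norms.L2Operator in
lemma exists_specPNorm_top_map_le
    (T : Matrix (Fin n) (Fin n) ℂ →ₗ[ℝ] Matrix (Fin n) (Fin n) ℂ)
    (hT : ∀ A : Matrix (Fin n) (Fin n) ℂ, A.IsHermitian → (T A).IsHermitian) :
    ∃ C : ℝ, 0 ≤ C ∧ ∀ A : Matrix (Fin n) (Fin n) ℂ, A.IsHermitian →
      specPNorm ∞ (T A) ≤ C * specPNorm ∞ A := by
  refine ⟨‖LinearMap.toContinuousLinearMap T‖, norm_nonneg _, fun A hA => ?_⟩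
  rw [specPNorm_top_eq_l2_opNorm hA, specPNorm_top_eq_l2_opNorm (hT A hA)]
  exact (LinearMap.toContinuousLinearMap T).le_opNorm A

open scoped Matrix.Norms.L2Operator in
lemma specPNorm_pos {A : Matrix (Fin n) (Fin n) ℂ} (hA : A.IsHermitian) (hA0 : A ≠ 0)
    {p : ℝ≥0∞} (hp : 1 ≤ p) : 0 < specPNorm p A := by
  refine lt_of_lt_of_le ?_ (specPNorm_top_le hA hp)
  rw [specPNorm_top_eq_l2_opNorm hA]
  exact norm_pos_iff.2 hA0

open scoped Matrix.Norms.L2Operator in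
lemma specPNorm_zero {p : ℝ≥0∞} (hp : 1 ≤ p) :
    specPNorm p (0 : Matrix (Fin n) (Fin n) ℂ) = 0 := by
  refine le_antisymm ((specPNorm_le_mul_top Matrix.isHermitian_zero hp).trans_eq ?_)
    (specPNorm_nonneg _ _)
  rw [specPNorm_top_eq_l2_opNorm Matrix.isHermitian_zero, norm_zero, mul_zero]

lemma specPNorm_map_le (T : Matrix (Fin n) (Fin n) ℂ →ₗ[ℝ] Matrix (Fin n) (Fin n) ℂ)
    (hT : ∀ A : Matrix (Fin n) (Fin n) ℂ, A.IsHermitian → (T A).IsHermitian)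
    {p : ℝ≥0∞} (hp : 1 ≤ p) {A : Matrix (Fin n) (Fin n) ℂ} (hA : A.IsHermitian) :
    specPNorm p (T A) ≤ hermOpNorm p p T * specPNorm p A := by
  rcases eq_or_ne A 0 with rfl | hA0
  · simp [specPNorm_zero hp]
  rw [← div_le_iff₀ (specPNorm_pos hA hA0 hp)]
  obtain ⟨C, hC0, hC⟩ := exists_specPNorm_top_map_le T hT
  refine le_ciSup (f := fun A : {A : Matrix (Fin n) (Fin n) ℂ // A.IsHermitian ∧ A ≠ 0} =>
    specPNorm p (T A.1) / specPNorm p A.1) ⟨((n : ℝ) + 1) ^ (1 / p.toReal) * C, ?_⟩ ⟨A, hA, hA0⟩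
  rintro _ ⟨⟨B, hB, hB0⟩, rfl⟩
  rw [div_le_iff₀ (specPNorm_pos hB hB0 hp), mul_assoc]
  refine (specPNorm_le_mul_top (hT B hB) hp).trans ?_
  gcongr
  exact (hC B hB).trans (by gcongr; exact specPNorm_top_le hB hp)

lemma continuousAt_specPNorm_ofReal {A : Matrix (Fin n) (Fin n) ℂ} (hA : A.IsHermitian) {p : ℝ}
    (hp : 0 < p) : ContinuousAt (fun q : ℝ => specPNorm (ENNReal.ofReal q) A) p := by
  have h : ContinuousAt (fun q : ℝ => (∑ i, |hA.eigenvalues i| ^ q) ^ (1 / q)) p := by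
    refine ContinuousAt.rpow (tendsto_finsetSum _ fun i _ => ?_)
      (continuousAt_const.div continuousAt_id hp.ne') (Or.inr (by positivity))
    exact ContinuousAt.rpow continuousAt_const continuousAt_id (Or.inr hp)
  refine h.congr ?_
  filter_upwards [lt_mem_nhds hp] with q hq
  exact (specPNorm_ofReal hA hq.le).symm

/-- Interpolation of `r`- and `s`-power trace bounds for finite exponents. -/
lemma sum_abs_eigenvalues_rpow_map_le
    (T : Matrix (Fin n) (Fin n) ℂ →ₗ[ℝ] Matrix (Fin n) (Fin n) ℂ)
    (hT : ∀ A : Matrix (Fin n) (Fin n) ℂ, A.IsHermitian → (T A).IsHermitian)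
    {r s η K L : ℝ} (hr : 1 ≤ r) (hs : 1 ≤ s) (hη0 : 0 < η) (hη1 : η < 1) (hK : 0 < K) (hL : 0 < L)
    (hTr : ∀ (A : Matrix (Fin n) (Fin n) ℂ) (hA : A.IsHermitian),
      ∑ i, |(hT A hA).eigenvalues i| ^ r ≤ K * ∑ i, |hA.eigenvalues i| ^ r)
    (hTs : ∀ (A : Matrix (Fin n) (Fin n) ℂ) (hA : A.IsHermitian),
      ∑ i, |(hT A hA).eigenvalues i| ^ s ≤ L * ∑ i, |hA.eigenvalues i| ^ s)
    {A : Matrix (Fin n) (Fin n) ℂ} (hA : A.IsHermitian) :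
    ∑ i, |(hT A hA).eigenvalues i| ^ ((1 - η) * r + η * s) ≤
      K * (L / K) ^ η * ∑ i, |hA.eigenvalues i| ^ ((1 - η) * r + η * s) := by
  have hr0 : 0 < r := by linarith
  have hs0 : 0 < s := by linarith
  refine sum_rpow_le_of_splitGauge_le hr0 hs0 hη0 hη1 (div_pos hL hK) fun t ht => ?_
  choose u v huv hF using fun i =>
    exists_splitGauge_eq hr0 hs0 (L / K * t) (hA.eigenvalues i)
  set a := conjDiag hA.eigenvectorUnitary u
  set b := conjDiag hA.eigenvectorUnitary v
  have ha : a.IsHermitian := isHermitian_conjDiag _ _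
  have hb : b.IsHermitian := isHermitian_conjDiag _ _
  have hab : A = a + b := by
    rw [← conjDiag_add, funext huv, hA.conjDiag_eigenvalues]
  set U := (hT A hA).eigenvectorUnitary
  set x : Fin n → ℝ := fun i => ((star (U : Matrix (Fin n) (Fin n) ℂ) * T a *
    (U : Matrix (Fin n) (Fin n) ℂ)) i i).re
  set z : Fin n → ℝ := fun i => ((star (U : Matrix (Fin n) (Fin n) ℂ) * T b *
    (U : Matrix (Fin n) (Fin n) ℂ)) i i).re
  have hxz : ∀ i, (hT A hA).eigenvalues i = x i + z i := by
    intro i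
    have hTab : T A = T a + T b := by rw [← map_add, ← hab]
    calc (hT A hA).eigenvalues i = ((star (U : Matrix (Fin n) (Fin n) ℂ) * T A *
          (U : Matrix (Fin n) (Fin n) ℂ)) i i).re := (hT A hA).eigenvalues_eq_re_diag i
      _ = ((star (U : Matrix (Fin n) (Fin n) ℂ) * (T a + T b) *
          (U : Matrix (Fin n) (Fin n) ℂ)) i i).re :=
        congr_arg (fun M => ((star (U : Matrix (Fin n) (Fin n) ℂ) * M *
          (U : Matrix (Fin n) (Fin n) ℂ)) i i).re) hTab
      _ = x i + z i := by rw [mul_add, add_mul, Matrix.add_apply, Complex.add_re]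
  have hx : ∑ i, |x i| ^ r ≤ K * ∑ i, |u i| ^ r :=
    (sum_convex_re_diag_le (convexOn_abs_rpow hr) U (hT a ha)).trans ((hTr a ha).trans
      (mul_le_mul_of_nonneg_left
        (sum_convex_eigenvalues_conjDiag_le (convexOn_abs_rpow hr) _ u) hK.le))
  have hz : ∑ i, |z i| ^ s ≤ L * ∑ i, |v i| ^ s :=
    (sum_convex_re_diag_le (convexOn_abs_rpow hs) U (hT b hb)).trans ((hTs b hb).trans
      (mul_le_mul_of_nonneg_left
        (sum_convex_eigenvalues_conjDiag_le (convexOn_abs_rpow hs) _ v) hL.le))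
  calc ∑ i, splitGauge r s t ((hT A hA).eigenvalues i)
      ≤ ∑ i, (|x i| ^ r + t * |z i| ^ s) := Finset.sum_le_sum fun i _ => by
        rw [hxz i]; exact splitGauge_add_le hr0 hs0 ht.le _ _
    _ = ∑ i, |x i| ^ r + t * ∑ i, |z i| ^ s := by rw [Finset.sum_add_distrib, Finset.mul_sum]
    _ ≤ K * ∑ i, |u i| ^ r + t * (L * ∑ i, |v i| ^ s) := by gcongr
    _ = K * ∑ i, (|u i| ^ r + L / K * t * |v i| ^ s) := by
        rw [Finset.sum_add_distrib, ← Finset.mul_sum]; field_simp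
    _ = K * ∑ i, splitGauge r s (L / K * t) (hA.eigenvalues i) := by simp_rw [hF]

lemma sum_rpow_map_le_of_specPNorm_le
    (T : Matrix (Fin n) (Fin n) ℂ →ₗ[ℝ] Matrix (Fin n) (Fin n) ℂ)
    (hT : ∀ A : Matrix (Fin n) (Fin n) ℂ, A.IsHermitian → (T A).IsHermitian)
    {r M : ℝ} (hr : 0 < r) (hM : 0 ≤ M) {A : Matrix (Fin n) (Fin n) ℂ} (hA : A.IsHermitian)
    (h : specPNorm (ENNReal.ofReal r) (T A) ≤ M * specPNorm (ENNReal.ofReal r) A) :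
    ∑ i, |(hT A hA).eigenvalues i| ^ r ≤ M ^ r * ∑ i, |hA.eigenvalues i| ^ r := by
  rw [specPNorm_ofReal hA hr.le, specPNorm_ofReal (hT A hA) hr.le] at h
  have h' := Real.rpow_le_rpow (by positivity) h hr.le
  rwa [Real.mul_rpow hM (by positivity), ← Real.rpow_mul (by positivity),
    ← Real.rpow_mul (by positivity), one_div_mul_cancel hr.ne', Real.rpow_one, Real.rpow_one] at h'

lemma specPNorm_map_le_of_finite
    (T : Matrix (Fin n) (Fin n) ℂ →ₗ[ℝ] Matrix (Fin n) (Fin n) ℂ)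
    (hT : ∀ A : Matrix (Fin n) (Fin n) ℂ, A.IsHermitian → (T A).IsHermitian)
    {r s p θ M N : ℝ} (hr : 1 ≤ r) (hs : 1 ≤ s) (hθ0 : 0 < θ) (hθ1 : θ < 1)
    (hp : 1 / p = (1 - θ) / r + θ / s) (hM : 0 < M) (hN : 0 < N)
    (hTr : ∀ A : Matrix (Fin n) (Fin n) ℂ, A.IsHermitian →
      specPNorm (ENNReal.ofReal r) (T A) ≤ M * specPNorm (ENNReal.ofReal r) A)
    (hTs : ∀ A : Matrix (Fin n) (Fin n) ℂ, A.IsHermitian →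
      specPNorm (ENNReal.ofReal s) (T A) ≤ N * specPNorm (ENNReal.ofReal s) A)
    {A : Matrix (Fin n) (Fin n) ℂ} (hA : A.IsHermitian) :
    specPNorm (ENNReal.ofReal p) (T A) ≤
      M ^ (1 - θ) * N ^ θ * specPNorm (ENNReal.ofReal p) A := by
  have hr0 : 0 < r := by linarith
  have hs0 : 0 < s := by linarith
  have hθ' : 0 < 1 - θ := by linarith
  have hp0 : 0 < p := one_div_pos.1 (by rw [hp]; positivity)
  have hη : θ * p / s + (1 - θ) * p / r = 1 := by
    calc θ * p / s + (1 - θ) * p / r = ((1 - θ) / r + θ / s) * p := by ring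
      _ = 1 := by rw [← hp, one_div_mul_cancel hp0.ne']
  set η := θ * p / s with hηd
  have hη0 : 0 < η := by positivity
  have hη1 : η < 1 := by
    have : 0 < (1 - θ) * p / r := by positivity
    linarith
  have hηs : η * s = θ * p := by rw [hηd]; field_simp
  have hηr : (1 - η) * r = (1 - θ) * p := by
    rw [show 1 - η = (1 - θ) * p / r by linarith, div_mul_cancel₀ _ hr0.ne']
  have hpe : (1 - η) * r + η * s = p := by rw [hηr, hηs]; ring
  have hconst : M ^ r * (N ^ s / M ^ r) ^ η = (M ^ (1 - θ) * N ^ θ) ^ p := by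
    rw [Real.div_rpow (by positivity) (by positivity), Real.mul_rpow (by positivity)
      (by positivity), ← Real.rpow_mul hM.le, ← Real.rpow_mul hM.le, ← Real.rpow_mul hN.le,
      ← Real.rpow_mul hN.le, ← hηr, ← hηs, mul_div_left_comm, ← Real.rpow_sub hM, mul_comm s η,
      mul_comm (N ^ _)]
    ring_nf
  have key := sum_abs_eigenvalues_rpow_map_le T hT hr hs hη0 hη1 (Real.rpow_pos_of_pos hM r)
    (Real.rpow_pos_of_pos hN s)
    (fun B hB => sum_rpow_map_le_of_specPNorm_le T hT hr0 hM.le hB (hTr B hB))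
    (fun B hB => sum_rpow_map_le_of_specPNorm_le T hT hs0 hN.le hB (hTs B hB)) hA
  rw [hpe, hconst] at key
  rw [specPNorm_ofReal hA hp0.le, specPNorm_ofReal (hT A hA) hp0.le]
  refine (Real.rpow_le_rpow (by positivity) key (by positivity)).trans_eq ?_
  rw [Real.mul_rpow (by positivity) (by positivity), ← Real.rpow_mul (by positivity),
    mul_one_div_cancel hp0.ne', Real.rpow_one]

open Filter Topology in
lemma specPNorm_map_le_of_top
    (T : Matrix (Fin n) (Fin n) ℂ →ₗ[ℝ] Matrix (Fin n) (Fin n) ℂ)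
    (hT : ∀ A : Matrix (Fin n) (Fin n) ℂ, A.IsHermitian → (T A).IsHermitian)
    {r p θ M N : ℝ} (hr : 1 ≤ r) (hθ0 : 0 < θ) (hθ1 : θ < 1)
    (hp : 1 / p = (1 - θ) / r) (hM : 0 < M) (hN : 0 < N)
    (hTr : ∀ A : Matrix (Fin n) (Fin n) ℂ, A.IsHermitian →
      specPNorm (ENNReal.ofReal r) (T A) ≤ M * specPNorm (ENNReal.ofReal r) A)
    (hTs : ∀ A : Matrix (Fin n) (Fin n) ℂ, A.IsHermitian →
      specPNorm ∞ (T A) ≤ N * specPNorm ∞ A)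
    {A : Matrix (Fin n) (Fin n) ℂ} (hA : A.IsHermitian) :
    specPNorm (ENNReal.ofReal p) (T A) ≤
      M ^ (1 - θ) * N ^ θ * specPNorm (ENNReal.ofReal p) A := by
  have hθ' : 0 < 1 - θ := by linarith
  have hp0 : 0 < p := one_div_pos.1 (by rw [hp]; positivity)
  have hinv : Tendsto (fun q : ℝ => 1 / q) atTop (𝓝 0) := by
    simpa using tendsto_inv_atTop_zero (𝕜 := ℝ)
  have hexp : Tendsto (fun q : ℝ => 1 / ((1 - θ) / r + θ / q)) atTop (𝓝 p) := by
    have h : Tendsto (fun q : ℝ => 1 / ((1 - θ) / r + θ * (1 / q))) atTop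
        (𝓝 (1 / ((1 - θ) / r + θ * 0))) :=
      tendsto_const_nhds.div (tendsto_const_nhds.add (tendsto_const_nhds.mul hinv))
        (by rw [mul_zero, add_zero]; positivity)
    simpa only [mul_zero, add_zero, ← hp, one_div_one_div, mul_one_div] using h
  have hcst : Tendsto (fun q : ℝ => M ^ (1 - θ) * (((n : ℝ) + 1) ^ (1 / q) * N) ^ θ) atTop
      (𝓝 (M ^ (1 - θ) * N ^ θ)) := by
    have h1 : Tendsto (fun q : ℝ => ((n : ℝ) + 1) ^ (1 / q) * N) atTop (𝓝 N) := by
      have := (tendsto_const_nhds (x := (n : ℝ) + 1)).rpow hinv (Or.inl (by positivity))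
      simpa using this.mul_const N
    exact (h1.rpow_const (Or.inl hN.ne')).const_mul _
  refine le_of_tendsto_of_tendsto
    ((continuousAt_specPNorm_ofReal (hT A hA) hp0).tendsto.comp hexp)
    (hcst.mul ((continuousAt_specPNorm_ofReal hA hp0).tendsto.comp hexp)) ?_
  filter_upwards [eventually_ge_atTop 1] with q hq
  have hq1 : 1 ≤ ENNReal.ofReal q := ENNReal.one_le_ofReal.2 hq
  refine specPNorm_map_le_of_finite T hT hr hq hθ0 hθ1 (one_div_one_div _) hM (by positivity) hTr
    (fun B hB => ?_) hA
  have h1 := specPNorm_le_mul_top (hT B hB) hq1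
  rw [ENNReal.toReal_ofReal (by linarith)] at h1
  rw [mul_assoc]
  refine h1.trans ?_
  gcongr
  exact (hTs B hB).trans (by gcongr; exact specPNorm_top_le hB hq1)

lemma specPNorm_map_le_of_specPNorm_le
    (T : Matrix (Fin n) (Fin n) ℂ →ₗ[ℝ] Matrix (Fin n) (Fin n) ℂ)
    (hT : ∀ A : Matrix (Fin n) (Fin n) ℂ, A.IsHermitian → (T A).IsHermitian)
    {r s p : ℝ≥0∞} {θ M N : ℝ} (hr : 1 ≤ r) (hs : 1 ≤ s) (hp : 1 ≤ p) (hθ0 : 0 < θ) (hθ1 : θ < 1)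
    (hrsp : 1 / p = ENNReal.ofReal (1 - θ) / r + ENNReal.ofReal θ / s) (hM : 0 < M) (hN : 0 < N)
    (hTr : ∀ A : Matrix (Fin n) (Fin n) ℂ, A.IsHermitian →
      specPNorm r (T A) ≤ M * specPNorm r A)
    (hTs : ∀ A : Matrix (Fin n) (Fin n) ℂ, A.IsHermitian →
      specPNorm s (T A) ≤ N * specPNorm s A)
    {A : Matrix (Fin n) (Fin n) ℂ} (hA : A.IsHermitian) :
    specPNorm p (T A) ≤ M ^ (1 - θ) * N ^ θ * specPNorm p A := by
  have hθ' : 0 < 1 - θ := by linarith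
  have one_le_toReal : ∀ {q : ℝ≥0∞}, 1 ≤ q → q ≠ ∞ → 1 ≤ q.toReal := fun h h' => by
    simpa using ENNReal.toReal_mono h' h
  have hreal : 1 / p.toReal = (1 - θ) / r.toReal + θ / s.toReal := by
    have h := congr_arg ENNReal.toReal hrsp
    rwa [ENNReal.toReal_add (ENNReal.div_ne_top ENNReal.ofReal_ne_top (one_pos.trans_le hr).ne')
      (ENNReal.div_ne_top ENNReal.ofReal_ne_top (one_pos.trans_le hs).ne'), ENNReal.toReal_div,
      ENNReal.toReal_div, ENNReal.toReal_div, ENNReal.toReal_ofReal hθ0.le,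
      ENNReal.toReal_ofReal hθ'.le, ENNReal.toReal_one] at h
  have hp_ne : (r ≠ ∞ ∨ s ≠ ∞) → p ≠ ∞ := by
    rintro h rfl
    rw [ENNReal.toReal_top, div_zero] at hreal
    rcases h with h | h
    · have h1 : 0 < (1 - θ) / r.toReal := div_pos hθ' (one_pos.trans_le (one_le_toReal hr h))
      have h2 : 0 ≤ θ / s.toReal := by positivity
      linarith
    · have h1 : 0 < θ / s.toReal := div_pos hθ0 (one_pos.trans_le (one_le_toReal hs h))
      have h2 : 0 ≤ (1 - θ) / r.toReal := by positivity
      linarith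
  rcases eq_or_ne r ∞ with rfl | hrt <;> rcases eq_or_ne s ∞ with rfl | hst
  · obtain rfl : p = ∞ := by simpa using hrsp
    have h0 := specPNorm_nonneg ∞ (T A)
    have h0' := specPNorm_nonneg ∞ A
    calc specPNorm ∞ (T A) = specPNorm ∞ (T A) ^ (1 - θ) * specPNorm ∞ (T A) ^ θ := by
          rw [← Real.rpow_add_of_nonneg h0 hθ'.le hθ0.le]; simp
      _ ≤ (M * specPNorm ∞ A) ^ (1 - θ) * (N * specPNorm ∞ A) ^ θ := by
          gcongr
          · exact hTr A hA
          · exact hTs A hA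
      _ = M ^ (1 - θ) * N ^ θ * (specPNorm ∞ A ^ (1 - θ) * specPNorm ∞ A ^ θ) := by
          rw [Real.mul_rpow hM.le h0', Real.mul_rpow hN.le h0']; ring
      _ = M ^ (1 - θ) * N ^ θ * specPNorm ∞ A := by
          rw [← Real.rpow_add_of_nonneg h0' hθ'.le hθ0.le]; simp
  · have hpt := hp_ne (Or.inr hst)
    rw [ENNReal.toReal_top, div_zero, zero_add] at hreal
    rw [← ENNReal.ofReal_toReal hpt, mul_comm (M ^ _)]
    have h := specPNorm_map_le_of_top T hT (one_le_toReal hs hst) hθ' (by linarith)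
      (by rw [sub_sub_cancel]; exact hreal) hN hM (by rwa [ENNReal.ofReal_toReal hst]) hTr hA
    rwa [sub_sub_cancel] at h
  · have hpt := hp_ne (Or.inl hrt)
    rw [ENNReal.toReal_top, div_zero, add_zero] at hreal
    rw [← ENNReal.ofReal_toReal hpt]
    exact specPNorm_map_le_of_top T hT (one_le_toReal hr hrt) hθ0 hθ1 hreal hM hN
      (by rwa [ENNReal.ofReal_toReal hrt]) hTs hA
  · have hpt := hp_ne (Or.inl hrt)
    rw [← ENNReal.ofReal_toReal hpt]
    exact specPNorm_map_le_of_finite T hT (one_le_toReal hr hrt) (one_le_toReal hs hst) hθ0 hθ1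
      hreal hM hN (by rwa [ENNReal.ofReal_toReal hrt]) (by rwa [ENNReal.ofReal_toReal hst]) hA

end Interpolation

/-- Diagonal interpolation theorem in the Euclidean Jordan algebra of `n×n` complex Hermitian
matrices: if `1/p = (1-θ)/r + θ/s` then `‖T‖_{p→p} ≤ ‖T‖_{r→r}^{1-θ} ‖T‖_{s→s}^θ` for every
real-linear map `T` on Hermitian matrices. -/
theorem diagonal_interpolation_hermitian {n : ℕ} (r s p : ℝ≥0∞)
    (hr : 1 ≤ r) (hs : 1 ≤ s) (hp : 1 ≤ p)
    (θ : ℝ) (hθ0 : 0 ≤ θ) (hθ1 : θ ≤ 1)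
    (hrsp : 1 / p = ENNReal.ofReal (1 - θ) / r + ENNReal.ofReal θ / s)
    (T : Matrix (Fin n) (Fin n) ℂ →ₗ[ℝ] Matrix (Fin n) (Fin n) ℂ)
    (hT : ∀ A : Matrix (Fin n) (Fin n) ℂ, A.IsHermitian → (T A).IsHermitian) :
    hermOpNorm p p T ≤ hermOpNorm r r T ^ (1 - θ) * hermOpNorm s s T ^ θ := by
  rcases hθ0.eq_or_lt with rfl | hθ0
  · obtain rfl : p = r := by simpa using hrsp
    simp
  rcases hθ1.eq_or_lt with rfl | hθ1
  · obtain rfl : p = s := by simpa using hrsp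
    simp
  have hlim : Filter.Tendsto
      (fun ε : ℝ => (hermOpNorm r r T + ε) ^ (1 - θ) * (hermOpNorm s s T + ε) ^ θ)
      (nhdsWithin 0 (Set.Ioi 0)) (nhds (hermOpNorm r r T ^ (1 - θ) * hermOpNorm s s T ^ θ)) := by
    have hc : Continuous
        fun ε : ℝ => (hermOpNorm r r T + ε) ^ (1 - θ) * (hermOpNorm s s T + ε) ^ θ :=
      ((continuous_const.add continuous_id).rpow_const fun _ => Or.inr (by linarith)).mul
        ((continuous_const.add continuous_id).rpow_const fun _ => Or.inr hθ0.le)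
    simpa using (hc.tendsto 0).mono_left nhdsWithin_le_nhds
  refine ge_of_tendsto hlim ?_
  filter_upwards [self_mem_nhdsWithin] with ε hε
  have hε : 0 < ε := hε
  have hr0 := hermOpNorm_nonneg r r T
  have hs0 := hermOpNorm_nonneg s s T
  refine Real.iSup_le (fun ⟨A, hA, hA0⟩ => ?_) (by positivity)
  rw [div_le_iff₀ (specPNorm_pos hA hA0 hp)]
  refine specPNorm_map_le_of_specPNorm_le T hT hr hs hp hθ0 hθ1 hrsp (by positivity)
    (by positivity) (fun B hB => ?_) (fun B hB => ?_) hA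
  · exact (specPNorm_map_le T hT hr hB).trans
      (mul_le_mul_of_nonneg_right (by linarith) (specPNorm_nonneg _ _))
  · exact (specPNorm_map_le T hT hs hB).trans
      (mul_le_mul_of_nonneg_right (by linarith) (specPNorm_nonneg _ _))
end

section
/- Let r₀, r₁, s₀, s₁ ∈ [1,∞] and θ ∈ [0,1], and define r_θ, s_θ ∈ [1,∞] by 1/r_θ = (1−θ)/r₀ + θ/r₁ and 1/s_θ = (1−θ)/s₀ + θ/s₁ (with the convention 1/∞ = 0). Let C := max{ C_{r₀}·C_{s₀′}, C_{r₁}·C_{s₁′} }, where t′ denotes the conjugate exponent of t. Then for every linear map T : ℝⁿ → ℝⁿ one has ‖T‖_{r_θ→s_θ} ≤ C · ‖T‖_{r₀→s₀}^{1−θ} · ‖T‖_{r₁→s₁}^{θ}. -/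
open scoped ENNReal

/-- The `p`-norm of a vector in `ℝⁿ`, for `p ∈ [1,∞]` (`p = ∞` gives the max norm). -/
noncomputable def pNorm {n : ℕ} (p : ℝ≥0∞) (x : Fin n → ℝ) : ℝ :=
  if p = ∞ then ⨆ j, |x j| else (∑ j, |x j| ^ p.toReal) ^ (1 / p.toReal)

/-- The operator norm of a linear map `T : ℝⁿ → ℝⁿ` from the `r`-norm to the `s`-norm. -/
noncomputable def opNorm {n : ℕ} (r s : ℝ≥0∞)
    (T : (Fin n → ℝ) →ₗ[ℝ] (Fin n → ℝ)) : ℝ :=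
  ⨆ x : {x : Fin n → ℝ // x ≠ 0}, pNorm s (T x.1) / pNorm r x.1


/-- The constant `C_p`: `√2` for `1 ≤ p ≤ 2` and `2^(1/q)` (with `q` the conjugate exponent
of `p`, so `1/q = 1 - 1/p`) for `2 ≤ p ≤ ∞`. -/
noncomputable def Cp (p : ℝ≥0∞) : ℝ :=
  if p ≤ 2 then Real.sqrt 2 else (2 : ℝ) ^ (1 - 1/p).toReal

theorem pNorm_norm_eq {𝕜 : Type*} [RCLike 𝕜] {n : ℕ} (p : ℝ≥0∞) [hp : Fact (1 ≤ p)] (z : Fin n → 𝕜) :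
    pNorm p (fun j => ‖z j‖) = ‖WithLp.toLp p z‖ := by
  have h1 := hp.out
  unfold pNorm
  split_ifs with h
  · subst h
    simp [PiLp.norm_eq_ciSup]
  · have h0 : 0 < p.toReal := ENNReal.toReal_pos (by positivity) h
    simp [PiLp.norm_eq_sum h0]

theorem pNorm_eq_norm {n : ℕ} (p : ℝ≥0∞) [hp : Fact (1 ≤ p)] (x : Fin n → ℝ) :
    pNorm p x = ‖WithLp.toLp p x‖ := by
  rw [← pNorm_norm_eq]
  simp [pNorm]

theorem pNorm_nonneg {n : ℕ} (p : ℝ≥0∞) (x : Fin n → ℝ) : 0 ≤ pNorm p x := by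
  unfold pNorm
  split_ifs
  · exact Real.iSup_nonneg fun j => abs_nonneg _
  · positivity

theorem pNorm_le_one_iff_of_ne_top {n : ℕ} {p : ℝ≥0∞} (hp : 1 ≤ p) (hp' : p ≠ ∞) (x : Fin n → ℝ) :
    pNorm p x ≤ 1 ↔ ∑ j, |x j| ^ p.toReal ≤ 1 := by
  have h0 : 0 < p.toReal := ENNReal.toReal_pos (by positivity) hp'
  rw [pNorm, if_neg hp', one_div,
    Real.rpow_inv_le_iff_of_pos (by positivity) zero_le_one h0, Real.one_rpow]

theorem pNorm_top_le_iff {n : ℕ} {x : Fin n → ℝ} {c : ℝ} (hc : 0 ≤ c) :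
    pNorm ∞ x ≤ c ↔ ∀ j, |x j| ≤ c := by
  rw [pNorm, if_pos rfl]
  exact ⟨fun h j => (le_ciSup (Set.finite_range _).bddAbove j).trans h,
    fun h => Real.iSup_le h hc⟩

theorem abs_le_pNorm {n : ℕ} {p : ℝ≥0∞} (hp : 1 ≤ p) (x : Fin n → ℝ) (j : Fin n) :
    |x j| ≤ pNorm p x := by
  have : Fact (1 ≤ p) := ⟨hp⟩
  rw [pNorm_eq_norm]
  exact PiLp.norm_apply_le (WithLp.toLp p x) j

theorem pNorm_mono {n : ℕ} (p : ℝ≥0∞) {x y : Fin n → ℝ} (h : ∀ j, |x j| ≤ |y j|) :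
    pNorm p x ≤ pNorm p y := by
  unfold pNorm
  split_ifs
  · exact ciSup_mono (Set.finite_range _).bddAbove h
  · refine Real.rpow_le_rpow (by positivity) (Finset.sum_le_sum fun j _ => ?_) (by positivity)
    exact Real.rpow_le_rpow (abs_nonneg _) (h j) (by positivity)

theorem opNorm_nonneg {n : ℕ} (r s : ℝ≥0∞) (T : (Fin n → ℝ) →ₗ[ℝ] (Fin n → ℝ)) :
    0 ≤ opNorm r s T :=
  Real.iSup_nonneg fun _ => div_nonneg (pNorm_nonneg _ _) (pNorm_nonneg _ _)

theorem pNorm_apply_le_opNorm {n : ℕ} {r s : ℝ≥0∞} (hr : 1 ≤ r) (hs : 1 ≤ s)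
    (T : (Fin n → ℝ) →ₗ[ℝ] (Fin n → ℝ)) (x : Fin n → ℝ) :
    pNorm s (T x) ≤ opNorm r s T * pNorm r x := by
  have : Fact (1 ≤ r) := ⟨hr⟩
  have : Fact (1 ≤ s) := ⟨hs⟩
  by_cases hx : x = 0
  · subst hx
    simp [pNorm_eq_norm]
  have hpos : 0 < pNorm r x := by
    rw [pNorm_eq_norm]
    simpa using hx
  let S : PiLp r (fun _ : Fin n => ℝ) →L[ℝ] PiLp s (fun _ : Fin n => ℝ) :=
    LinearMap.toContinuousLinearMap ((WithLp.linearEquiv s ℝ (Fin n → ℝ)).symm.toLinearMap ∘ₗ T ∘ₗ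
      (WithLp.linearEquiv r ℝ (Fin n → ℝ)).toLinearMap)
  have hb : BddAbove (Set.range fun x : {x : Fin n → ℝ // x ≠ 0} =>
      pNorm s (T x.1) / pNorm r x.1) := by
    refine ⟨‖S‖, ?_⟩
    rintro _ ⟨y, rfl⟩
    refine div_le_of_le_mul₀ (pNorm_nonneg _ _) (norm_nonneg _) ?_
    rw [pNorm_eq_norm, pNorm_eq_norm]
    exact S.le_opNorm (WithLp.toLp r y.1)
  rw [← div_le_iff₀ hpos]
  exact le_ciSup hb ⟨x, hx⟩

theorem linearMap_apply_eq_sum {n : ℕ} (T : (Fin n → ℝ) →ₗ[ℝ] (Fin n → ℝ)) (x : Fin n → ℝ)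
    (j : Fin n) : T x j = ∑ k, T (Pi.single k 1) j * x k := by
  conv_lhs => rw [← LinearMap.toMatrix'_mulVec T x]
  simp [Matrix.mulVec, dotProduct, LinearMap.toMatrix'_apply]

theorem pNorm_complexification_le {n : ℕ} {r s : ℝ≥0∞} (hr : 1 ≤ r) (hs : 1 ≤ s)
    (T : (Fin n → ℝ) →ₗ[ℝ] (Fin n → ℝ)) (z : Fin n → ℂ) :
    pNorm s (fun j => ‖∑ k, (T (Pi.single k 1) j : ℂ) * z k‖) ≤
      2 * opNorm r s T * pNorm r (fun j => ‖z j‖) := by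
  have : Fact (1 ≤ s) := ⟨hs⟩
  set u : Fin n → ℝ := fun k => (z k).re
  set v : Fin n → ℝ := fun k => (z k).im
  have hz : (fun j => ∑ k, (T (Pi.single k 1) j : ℂ) * z k) =
      (fun j => (T u j : ℂ)) + Complex.I • (fun j => (T v j : ℂ)) := by
    funext j
    rw [Pi.add_apply, Pi.smul_apply, smul_eq_mul, linearMap_apply_eq_sum T u, linearMap_apply_eq_sum T v]
    push_cast
    rw [Finset.mul_sum, ← Finset.sum_add_distrib]
    refine Finset.sum_congr rfl fun k _ => ?_
    conv_lhs => rw [← Complex.re_add_im (z k)]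
    simp only [u, v]
    ring
  have hreal (x : Fin n → ℝ) : ‖WithLp.toLp s (fun j => (x j : ℂ))‖ = pNorm s x := by
    rw [← pNorm_norm_eq]
    simp [pNorm]
  have hu : pNorm r u ≤ pNorm r (fun j => ‖z j‖) :=
    pNorm_mono r fun j => by simpa using Complex.abs_re_le_norm (z j)
  have hv : pNorm r v ≤ pNorm r (fun j => ‖z j‖) :=
    pNorm_mono r fun j => by simpa using Complex.abs_im_le_norm (z j)
  have h0 := opNorm_nonneg r s T
  calc _ = ‖WithLp.toLp s (fun j => (T u j : ℂ)) +
          Complex.I • WithLp.toLp s (fun j => (T v j : ℂ))‖ := by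
        rw [pNorm_norm_eq s (fun j => ∑ k, (T (Pi.single k 1) j : ℂ) * z k), hz]
        rfl
    _ ≤ pNorm s (T u) + pNorm s (T v) := by
        refine (norm_add_le _ _).trans ?_
        rw [norm_smul, hreal, hreal]
        simp
    _ ≤ opNorm r s T * pNorm r u + opNorm r s T * pNorm r v :=
        add_le_add (pNorm_apply_le_opNorm hr hs T u) (pNorm_apply_le_opNorm hr hs T v)
    _ ≤ _ := by nlinarith

theorem sqrt_two_le_Cp (p : ℝ≥0∞) : Real.sqrt 2 ≤ Cp p := by
  unfold Cp
  split_ifs with h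
  · rfl
  · rw [Real.sqrt_eq_rpow]
    refine Real.rpow_le_rpow_of_exponent_le one_le_two ?_
    have h2 : 1 / p ≤ 2⁻¹ := by
      rw [one_div]
      exact ENNReal.inv_le_inv.2 (not_le.1 h).le
    have h3 : (2⁻¹ : ℝ≥0∞) ≤ 1 - 1 / p := by
      rw [← ENNReal.one_sub_inv_two]
      exact tsub_le_tsub_left h2 1
    simpa using ENNReal.toReal_mono (by finiteness) h3

theorem two_le_Cp_mul_Cp (p q : ℝ≥0∞) : 2 ≤ Cp p * Cp q := by
  rw [← Real.mul_self_sqrt (zero_le_two : (0 : ℝ) ≤ 2)]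
  exact mul_le_mul (sqrt_two_le_Cp p) (sqrt_two_le_Cp q) (by positivity)
    ((Real.sqrt_nonneg 2).trans (sqrt_two_le_Cp p))

theorem pNorm_one {n : ℕ} (x : Fin n → ℝ) : pNorm 1 x = ∑ j, |x j| := by
  simp [pNorm]

theorem toReal_holderConjugate {p q : ℝ≥0∞} [p.HolderConjugate q] (hp : p ≠ ∞) (hq : q ≠ ∞) :
    p.toReal.HolderConjugate q.toReal := by
  have hp1 : 1 ≤ p := ENNReal.HolderConjugate.one_le p q
  have hq1 : 1 ≤ q := ENNReal.HolderConjugate.one_le q p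
  have h := congrArg ENNReal.toReal (ENNReal.HolderConjugate.inv_add_inv_eq_one p q)
  rw [ENNReal.toReal_add (by simp; positivity) (by simp; positivity)] at h
  simp only [ENNReal.toReal_inv, ENNReal.toReal_one] at h
  exact ⟨by simpa using h, ENNReal.toReal_pos (by positivity) hp,
    ENNReal.toReal_pos (by positivity) hq⟩

theorem sum_abs_mul_abs_le_of_top {n : ℕ} (a b : Fin n → ℝ) :
    ∑ j, |a j| * |b j| ≤ pNorm ∞ a * pNorm 1 b := by
  rw [pNorm_one, Finset.mul_sum]
  exact Finset.sum_le_sum fun j _ =>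
    mul_le_mul_of_nonneg_right (abs_le_pNorm le_top a j) (abs_nonneg _)

theorem sum_abs_mul_abs_le {n : ℕ} (p q : ℝ≥0∞) [hpq : p.HolderConjugate q] (a b : Fin n → ℝ) :
    ∑ j, |a j| * |b j| ≤ pNorm p a * pNorm q b := by
  by_cases hp : p = ∞
  · subst hp
    obtain rfl : q = 1 := ENNReal.HolderConjugate.unique ∞ q 1
    exact sum_abs_mul_abs_le_of_top a b
  by_cases hq : q = ∞
  · subst hq
    obtain rfl : p = 1 := ENNReal.HolderConjugate.unique ∞ p 1
    simp only [mul_comm |a _|]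
    rw [mul_comm]
    exact sum_abs_mul_abs_le_of_top b a
  rw [pNorm, pNorm, if_neg hp, if_neg hq]
  simpa using Real.inner_le_Lp_mul_Lq Finset.univ (fun j => |a j|) (fun j => |b j|)
    (toReal_holderConjugate hp hq)

theorem abs_sign_le_one (a : ℝ) : |(SignType.sign a : ℝ)| ≤ 1 := by
  rcases lt_trichotomy a 0 with h | h | h <;> simp [h]

/-- The dual characterisation of the `p`-norm: some vector of the dual unit ball attains it. -/
theorem exists_sum_mul_eq_pNorm {n : ℕ} (p q : ℝ≥0∞) [p.HolderConjugate q] (w : Fin n → ℝ) :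
    ∃ y : Fin n → ℝ, pNorm q y ≤ 1 ∧ ∑ j, w j * y j = pNorm p w := by
  by_cases hp : p = ∞
  · subst hp
    obtain rfl : q = 1 := ENNReal.HolderConjugate.unique ∞ q 1
    rcases isEmpty_or_nonempty (Fin n) with hn | hn
    · exact ⟨0, by simp [pNorm], by simp [pNorm]⟩
    obtain ⟨i, hi⟩ := exists_eq_ciSup_of_finite (f := fun j => |w j|)
    refine ⟨Pi.single i (SignType.sign (w i) : ℝ), ?_, ?_⟩
    · rw [pNorm_one, Finset.sum_eq_single i (fun j _ hj => by simp [hj]) (by simp)]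
      simpa using abs_sign_le_one (w i)
    · rw [Finset.sum_eq_single i (fun j _ hj => by simp [hj]) (by simp)]
      simp only [Pi.single_eq_same, self_mul_sign, hi, pNorm, if_true]
  by_cases hq : q = ∞
  · subst hq
    obtain rfl : p = 1 := ENNReal.HolderConjugate.unique ∞ p 1
    refine ⟨fun j => (SignType.sign (w j) : ℝ), ?_, by simp [pNorm_one]⟩
    rw [pNorm_top_le_iff zero_le_one]
    exact fun j => abs_sign_le_one _
  obtain ⟨g, hg, hgw⟩ := (NNReal.isGreatest_Lp Finset.univ (fun j => ‖w j‖₊)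
    (toReal_holderConjugate (p := p) hp hq)).1
  have hq1 : 1 ≤ q := ENNReal.HolderConjugate.one_le q p
  refine ⟨fun j => SignType.sign (w j) * g j, ?_, ?_⟩
  · rw [pNorm_le_one_iff_of_ne_top hq1 hq]
    have hg' : ∑ j, (g j : ℝ) ^ q.toReal ≤ 1 := by exact_mod_cast hg
    refine (Finset.sum_le_sum fun j _ => ?_).trans hg'
    refine Real.rpow_le_rpow (abs_nonneg _) ?_ (by positivity)
    rw [abs_mul, NNReal.abs_eq]
    exact mul_le_of_le_one_left (g j).2 (abs_sign_le_one _)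
  · have h := congrArg NNReal.toReal hgw
    simp only [← mul_assoc, self_mul_sign]
    rw [pNorm, if_neg hp]
    simpa using h

/-- Raising the entries of a vector of the unit ball of `ℓ^q` to the power `q / p` gives a vector
of the unit ball of `ℓ^p`. -/
theorem pNorm_rpow_le_one {n : ℕ} {p q : ℝ≥0∞} (hp : 1 ≤ p) (hq : 1 ≤ q) (hq' : q ≠ ∞)
    {x : Fin n → ℝ} (hx : pNorm q x ≤ 1) {v : Fin n → ℝ}
    (hv : ∀ j, |v j| ≤ |x j| ^ (q.toReal * p.toReal⁻¹)) :
    pNorm p v ≤ 1 := by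
  have hq0 : 0 < q.toReal := ENNReal.toReal_pos (by positivity) hq'
  by_cases hp' : p = ∞
  · subst hp'
    rw [pNorm_top_le_iff zero_le_one]
    exact fun j => (hv j).trans <|
      Real.rpow_le_one (abs_nonneg _) ((abs_le_pNorm hq x j).trans hx) (by positivity)
  have hp0 : 0 < p.toReal := ENNReal.toReal_pos (by positivity) hp'
  rw [pNorm_le_one_iff_of_ne_top hp hp']
  rw [pNorm_le_one_iff_of_ne_top hq hq'] at hx
  refine (Finset.sum_le_sum fun j _ => ?_).trans hx
  calc |v j| ^ p.toReal ≤ (|x j| ^ (q.toReal * p.toReal⁻¹)) ^ p.toReal :=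
        Real.rpow_le_rpow (abs_nonneg _) (hv j) hp0.le
    _ = |x j| ^ q.toReal := by
        rw [← Real.rpow_mul (abs_nonneg _), inv_mul_cancel_right₀ hp0.ne']

/-- A vector of the unit ball of `ℓ^p`, where `1/p` interpolates between `1/p₀` and `1/p₁`, extends
to a bounded holomorphic family on the strip with boundary values in the unit balls of `ℓ^{p₀}` and
`ℓ^{p₁}`. -/
theorem exists_analytic_family {n : ℕ} {p₀ p₁ p : ℝ≥0∞} (hp₀ : 1 ≤ p₀) (hp₁ : 1 ≤ p₁) (hp : 1 ≤ p)
    {θ : ℝ} (hθ0 : 0 < θ) (hθ1 : θ < 1)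
    (h : p⁻¹ = ENNReal.ofReal (1 - θ) * p₀⁻¹ + ENNReal.ofReal θ * p₁⁻¹)
    {x : Fin n → ℝ} (hx : pNorm p x ≤ 1) :
    ∃ f : ℂ → Fin n → ℂ, (∀ j, Differentiable ℂ fun z => f z j) ∧ (∀ j, f θ j = x j) ∧
      (∀ z : ℂ, 0 ≤ z.re → z.re ≤ 1 → ∀ j, ‖f z j‖ ≤ 1) ∧
      (∀ z : ℂ, z.re = 0 → pNorm p₀ (fun j => ‖f z j‖) ≤ 1) ∧
      (∀ z : ℂ, z.re = 1 → pNorm p₁ (fun j => ‖f z j‖) ≤ 1) := by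
  have hx1 (j) : |x j| ≤ 1 := (abs_le_pNorm hp x j).trans hx
  by_cases hp' : p = ∞
  · subst hp'
    have h' : p₀ = ∞ ∧ p₁ = ∞ := by
      simpa [hθ0.not_ge, hθ1.not_ge] using h.symm
    obtain ⟨rfl, rfl⟩ := h'
    have hc : pNorm ∞ (fun j => ‖(x j : ℂ)‖) ≤ 1 := by
      rw [pNorm_top_le_iff zero_le_one]
      simpa using hx1
    exact ⟨fun _ j => x j, fun j => differentiable_const _, fun j => rfl,
      fun z _ _ j => by simpa using hx1 j, fun z _ => hc, fun z _ => hc⟩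
  have hq0 : 0 < p.toReal := ENNReal.toReal_pos (by positivity) hp'
  have hre : p.toReal⁻¹ = (1 - θ) * p₀.toReal⁻¹ + θ * p₁.toReal⁻¹ := by
    have h' := congrArg ENNReal.toReal h
    have h0 : p₀⁻¹ ≠ ∞ := by simp; positivity
    have h1 : p₁⁻¹ ≠ ∞ := by simp; positivity
    rw [ENNReal.toReal_add (by finiteness) (by finiteness)] at h'
    simpa [ENNReal.toReal_ofReal, hθ0.le, hθ1.le] using h'
  let e : ℂ → ℂ := fun z => p.toReal * ((1 - z) * p₀.toReal⁻¹ + z * p₁.toReal⁻¹)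
  have he (z : ℂ) : (e z).re = p.toReal * ((1 - z.re) * p₀.toReal⁻¹ + z.re * p₁.toReal⁻¹) := by
    simp only [e, Complex.re_ofReal_mul, Complex.add_re,
      Complex.re_mul_ofReal, Complex.sub_re, Complex.one_re]
  let f : ℂ → Fin n → ℂ := fun z j => if x j = 0 then 0 else
    ((SignType.sign (x j) : ℝ) : ℂ) * ((|x j| : ℝ) : ℂ) ^ e z
  have hf (z : ℂ) (j : Fin n) : ‖f z j‖ ≤ |x j| ^ (e z).re := by
    by_cases hj : x j = 0
    · simp only [f, hj, if_true, norm_zero]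
      positivity
    · simp only [f, hj, if_false]
      rw [norm_mul, Complex.norm_cpow_eq_rpow_re_of_pos (abs_pos.2 hj), Complex.norm_real]
      exact mul_le_of_le_one_left (by positivity) (abs_sign_le_one _)
  refine ⟨f, fun j => ?_, fun j => ?_, fun z hz0 hz1 j => ?_, fun z hz => ?_, fun z hz => ?_⟩
  · by_cases hj : x j = 0
    · simp only [f, hj, if_true]
      exact differentiable_const _
    · simp only [f, hj, if_false]
      have hj' : ((|x j| : ℝ) : ℂ) ≠ 0 := by simpa using hj
      refine (differentiable_const _).mul (Differentiable.const_cpow ?_ (Or.inl hj'))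
      fun_prop
  · by_cases hj : x j = 0
    · simp [f, hj]
    · have h1 : e θ = 1 := by
        have : p.toReal * ((1 - θ) * p₀.toReal⁻¹ + θ * p₁.toReal⁻¹) = 1 := by
          rw [← hre, mul_inv_cancel₀ hq0.ne']
        simp only [e]
        exact_mod_cast this
      simp only [f, hj, if_false, h1, Complex.cpow_one]
      exact_mod_cast sign_mul_abs (x j)
  · refine (hf z j).trans (Real.rpow_le_one (abs_nonneg _) (hx1 j) ?_)
    rw [he]
    have : 0 ≤ 1 - z.re := by linarith
    positivity
  · refine pNorm_rpow_le_one hp₀ hp hp' hx fun j => ?_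
    have := hf z j
    rw [he, hz] at this
    simpa using this
  · refine pNorm_rpow_le_one hp₁ hp hp' hx fun j => ?_
    have := hf z j
    rw [he, hz] at this
    simpa using this

theorem conjugate_interpolation {s₀ s₁ s₀' s₁' s s' : ℝ≥0∞} [h₀ : s₀.HolderConjugate s₀']
    [h₁ : s₁.HolderConjugate s₁'] [h : s.HolderConjugate s'] {θ : ℝ} (hθ0 : 0 ≤ θ) (hθ1 : θ ≤ 1)
    (hs : s⁻¹ = ENNReal.ofReal (1 - θ) * s₀⁻¹ + ENNReal.ofReal θ * s₁⁻¹) :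
    s'⁻¹ = ENNReal.ofReal (1 - θ) * s₀'⁻¹ + ENNReal.ofReal θ * s₁'⁻¹ := by
  have e₀ := ENNReal.HolderConjugate.inv_add_inv_eq_one s₀ s₀'
  have e₁ := ENNReal.HolderConjugate.inv_add_inv_eq_one s₁ s₁'
  have e := ENNReal.HolderConjugate.inv_add_inv_eq_one s s'
  have hfin : s⁻¹ ≠ ∞ := fun H => by simp [H] at e
  have hθ : ENNReal.ofReal (1 - θ) + ENNReal.ofReal θ = 1 := by
    rw [← ENNReal.ofReal_add (by linarith) hθ0]
    simp
  refine (ENNReal.add_right_inj hfin).1 ?_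
  rw [e, hs]
  calc (1 : ℝ≥0∞) = ENNReal.ofReal (1 - θ) * (s₀⁻¹ + s₀'⁻¹) +
        ENNReal.ofReal θ * (s₁⁻¹ + s₁'⁻¹) := by rw [e₀, e₁, mul_one, mul_one, hθ]
    _ = _ := by ring

theorem one_le_of_interpolation {p₀ p₁ p : ℝ≥0∞} (hp₀ : 1 ≤ p₀) (hp₁ : 1 ≤ p₁) {θ : ℝ}
    (hθ0 : 0 ≤ θ) (hθ1 : θ ≤ 1)
    (h : p⁻¹ = ENNReal.ofReal (1 - θ) * p₀⁻¹ + ENNReal.ofReal θ * p₁⁻¹) : 1 ≤ p := by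
  rw [← ENNReal.inv_le_one, h]
  calc _ ≤ ENNReal.ofReal (1 - θ) * 1 + ENNReal.ofReal θ * 1 := by
        gcongr <;> rwa [ENNReal.inv_le_one]
    _ = 1 := by
        rw [mul_one, mul_one, ← ENNReal.ofReal_add (by linarith) hθ0]
        simp

theorem norm_sum_complexification_mul_le {n : ℕ} {r s s' : ℝ≥0∞} (hr : 1 ≤ r) [s.HolderConjugate s']
    (T : (Fin n → ℝ) →ₗ[ℝ] (Fin n → ℝ)) {u v : Fin n → ℂ} (hu : pNorm r (fun j => ‖u j‖) ≤ 1)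
    (hv : pNorm s' (fun j => ‖v j‖) ≤ 1) :
    ‖∑ j, (∑ k, (T (Pi.single k 1) j : ℂ) * u k) * v j‖ ≤ 2 * opNorm r s T := by
  have h0 := opNorm_nonneg r s T
  have hs : 1 ≤ s := ENNReal.HolderConjugate.one_le s s'
  refine (norm_sum_le _ _).trans ?_
  simp only [norm_mul _ (v _)]
  calc _ ≤ pNorm s (fun j => ‖∑ k, (T (Pi.single k 1) j : ℂ) * u k‖) *
          pNorm s' (fun j => ‖v j‖) := by
        simpa only [abs_norm] using sum_abs_mul_abs_le s s'
          (fun j => ‖∑ k, (T (Pi.single k 1) j : ℂ) * u k‖) (fun j => ‖v j‖)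
    _ ≤ pNorm s (fun j => ‖∑ k, (T (Pi.single k 1) j : ℂ) * u k‖) :=
        mul_le_of_le_one_right (pNorm_nonneg _ _) hv
    _ ≤ 2 * opNorm r s T * pNorm r (fun j => ‖u j‖) := pNorm_complexification_le hr hs T u
    _ ≤ _ := mul_le_of_le_one_right (by positivity) hu

theorem pNorm_apply_le_interp {n : ℕ} {r₀ r₁ s₀ s₁ r s : ℝ≥0∞}
    (hr₀ : 1 ≤ r₀) (hr₁ : 1 ≤ r₁) (hs₀ : 1 ≤ s₀) (hs₁ : 1 ≤ s₁)
    {θ : ℝ} (hθ0 : 0 < θ) (hθ1 : θ < 1)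
    (hr : r⁻¹ = ENNReal.ofReal (1 - θ) * r₀⁻¹ + ENNReal.ofReal θ * r₁⁻¹)
    (hs : s⁻¹ = ENNReal.ofReal (1 - θ) * s₀⁻¹ + ENNReal.ofReal θ * s₁⁻¹)
    (T : (Fin n → ℝ) →ₗ[ℝ] (Fin n → ℝ)) {x : Fin n → ℝ} (hx : pNorm r x ≤ 1) :
    pNorm s (T x) ≤ (2 * opNorm r₀ s₀ T) ^ (1 - θ) * (2 * opNorm r₁ s₁ T) ^ θ := by
  have hr1 := one_le_of_interpolation hr₀ hr₁ hθ0.le hθ1.le hr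
  have hs1 := one_le_of_interpolation hs₀ hs₁ hθ0.le hθ1.le hs
  have hconj (t : ℝ≥0∞) (ht : 1 ≤ t) : t.HolderConjugate (1 - t⁻¹)⁻¹ := by
    rw [ENNReal.holderConjugate_iff, inv_inv]
    exact add_tsub_cancel_of_le (ENNReal.inv_le_one.2 ht)
  have := hconj s hs1
  have := hconj s₀ hs₀
  have := hconj s₁ hs₁
  have hs' := conjugate_interpolation (s₀' := (1 - s₀⁻¹)⁻¹) (s₁' := (1 - s₁⁻¹)⁻¹)
    (s' := (1 - s⁻¹)⁻¹) hθ0.le hθ1.le hs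
  obtain ⟨y, hy, hyT⟩ := exists_sum_mul_eq_pNorm s (1 - s⁻¹)⁻¹ (T x)
  obtain ⟨f, hfd, hfθ, hfb, hf0, hf1⟩ := exists_analytic_family hr₀ hr₁ hr1 hθ0 hθ1 hr hx
  obtain ⟨g, hgd, hgθ, hgb, hg0, hg1⟩ := exists_analytic_family
    (ENNReal.HolderConjugate.one_le _ s₀) (ENNReal.HolderConjugate.one_le _ s₁)
    (ENNReal.HolderConjugate.one_le _ s) hθ0 hθ1 hs' hy
  let F : ℂ → ℂ := fun z => ∑ j, (∑ k, (T (Pi.single k 1) j : ℂ) * f z k) * g z j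
  have hF : Differentiable ℂ F := by
    refine Differentiable.fun_sum fun j _ => Differentiable.mul ?_ (hgd j)
    exact Differentiable.fun_sum fun k _ => (hfd k).const_mul _
  have hFθ : F θ = (pNorm s (T x) : ℝ) := by
    rw [← hyT]
    simp only [F, hfθ, hgθ, linearMap_apply_eq_sum T x]
    push_cast
    rfl
  have key := Complex.HadamardThreeLines.norm_le_interp_of_mem_verticalClosedStrip₀₁' F
    (z := (θ : ℂ)) (a := 2 * opNorm r₀ s₀ T) (b := 2 * opNorm r₁ s₁ T)
    (by simpa [Complex.HadamardThreeLines.verticalClosedStrip] using ⟨hθ0.le, hθ1.le⟩)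
    hF.diffContOnCl ?_ (fun z hz => norm_sum_complexification_mul_le hr₀ T (hf0 z hz) (hg0 z hz))
    (fun z hz => norm_sum_complexification_mul_le hr₁ T (hf1 z hz) (hg1 z hz))
  · rw [hFθ, Complex.norm_real, Complex.ofReal_re] at key
    exact (le_abs_self _).trans key
  · refine ⟨∑ j, ∑ k, |T (Pi.single k 1) j|, ?_⟩
    rintro _ ⟨z, hz, rfl⟩
    refine (norm_sum_le _ _).trans (Finset.sum_le_sum fun j _ => ?_)
    rw [norm_mul]
    refine (mul_le_of_le_one_right (norm_nonneg _) (hgb z hz.1 hz.2 j)).trans ?_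
    refine (norm_sum_le _ _).trans (Finset.sum_le_sum fun k _ => ?_)
    rw [norm_mul, Complex.norm_real]
    exact mul_le_of_le_one_right (norm_nonneg _) (hfb z hz.1 hz.2 k)

theorem opNorm_le_two_mul_interp {n : ℕ} {r₀ r₁ s₀ s₁ r s : ℝ≥0∞}
    (hr₀ : 1 ≤ r₀) (hr₁ : 1 ≤ r₁) (hs₀ : 1 ≤ s₀) (hs₁ : 1 ≤ s₁)
    {θ : ℝ} (hθ0 : 0 ≤ θ) (hθ1 : θ ≤ 1)
    (hr : r⁻¹ = ENNReal.ofReal (1 - θ) * r₀⁻¹ + ENNReal.ofReal θ * r₁⁻¹)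
    (hs : s⁻¹ = ENNReal.ofReal (1 - θ) * s₀⁻¹ + ENNReal.ofReal θ * s₁⁻¹)
    (T : (Fin n → ℝ) →ₗ[ℝ] (Fin n → ℝ)) :
    opNorm r s T ≤ 2 * (opNorm r₀ s₀ T ^ (1 - θ) * opNorm r₁ s₁ T ^ θ) := by
  have h0 := opNorm_nonneg r₀ s₀ T
  have h1 := opNorm_nonneg r₁ s₁ T
  rcases hθ0.eq_or_lt with rfl | hθ0'
  · obtain rfl : r = r₀ := by simpa using hr
    obtain rfl : s = s₀ := by simpa using hs
    simp
    linarith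
  rcases hθ1.eq_or_lt with rfl | hθ1'
  · obtain rfl : r = r₁ := by simpa using hr
    obtain rfl : s = s₁ := by simpa using hs
    simp
    linarith
  have : Fact (1 ≤ r) := ⟨one_le_of_interpolation hr₀ hr₁ hθ0 hθ1 hr⟩
  have : Fact (1 ≤ s) := ⟨one_le_of_interpolation hs₀ hs₁ hθ0 hθ1 hs⟩
  refine Real.iSup_le (fun x => ?_) (by positivity)
  have hpos : 0 < pNorm r x.1 := by
    rw [pNorm_eq_norm]
    simpa using x.2
  have hsmul (p : ℝ≥0∞) [Fact (1 ≤ p)] (v : Fin n → ℝ) :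
      pNorm p ((pNorm r x.1)⁻¹ • v) = (pNorm r x.1)⁻¹ * pNorm p v := by
    rw [pNorm_eq_norm p, WithLp.toLp_smul, norm_smul, ← pNorm_eq_norm,
      Real.norm_of_nonneg (inv_nonneg.2 hpos.le)]
  have key := pNorm_apply_le_interp hr₀ hr₁ hs₀ hs₁ hθ0' hθ1' hr hs T
    (x := (pNorm r x.1)⁻¹ • x.1) (by rw [hsmul, inv_mul_cancel₀ hpos.ne'])
  rw [map_smul, hsmul, Real.mul_rpow zero_le_two h0, Real.mul_rpow zero_le_two h1,
    mul_mul_mul_comm, ← Real.rpow_add two_pos, sub_add_cancel, Real.rpow_one] at key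
  rwa [div_eq_inv_mul]

/-- Riesz–Thorin type interpolation theorem in the Euclidean Jordan algebra `ℝⁿ`:
`‖T‖_{rθ→sθ} ≤ C ‖T‖_{r₀→s₀}^{1-θ} ‖T‖_{r₁→s₁}^θ` with
`C = max {C_{r₀} C_{s₀'}, C_{r₁} C_{s₁'}}`, where `s₀', s₁'` are conjugate exponents. -/
theorem riesz_thorin_interpolation {n : ℕ} (r₀ r₁ s₀ s₁ s₀' s₁' rθ sθ : ℝ≥0∞)
    (hr₀ : 1 ≤ r₀) (hr₁ : 1 ≤ r₁) (hs₀ : 1 ≤ s₀) (hs₁ : 1 ≤ s₁)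
    (θ : ℝ) (hθ0 : 0 ≤ θ) (hθ1 : θ ≤ 1)
    (hs₀' : 1 / s₀ + 1 / s₀' = 1) (hs₁' : 1 / s₁ + 1 / s₁' = 1)
    (hrθ : 1 / rθ = ENNReal.ofReal (1 - θ) / r₀ + ENNReal.ofReal θ / r₁)
    (hsθ : 1 / sθ = ENNReal.ofReal (1 - θ) / s₀ + ENNReal.ofReal θ / s₁)
    (T : (Fin n → ℝ) →ₗ[ℝ] (Fin n → ℝ)) :
    opNorm rθ sθ T ≤
      max (Cp r₀ * Cp s₀') (Cp r₁ * Cp s₁') * opNorm r₀ s₀ T ^ (1 - θ) * opNorm r₁ s₁ T ^ θ := by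
  refine (opNorm_le_two_mul_interp hr₀ hr₁ hs₀ hs₁ hθ0 hθ1 (by simpa [div_eq_mul_inv] using hrθ)
    (by simpa [div_eq_mul_inv] using hsθ) T).trans ?_
  have h0 := opNorm_nonneg r₀ s₀ T
  have h1 := opNorm_nonneg r₁ s₁ T
  rw [mul_assoc]
  exact mul_le_mul_of_nonneg_right ((two_le_Cp_mul_Cp r₀ s₀').trans (le_max_left _ _))
    (by positivity)
end
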